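/- Let X = (X₁, X₂) and Y = (Y₁, Y₂) be independent random vectors in ℝ^{2k}, each with i.i.d. centered Gaussian coordinates, with X₁, Y₁ the first k coordinates. Then for every x with 0 < x ≤ k/2: Pr[ ⟨X₁,Y₁⟩ ≤ (1/2)⟨X,Y⟩ − (5/2)√(x/k)(‖X‖² + ‖Y‖²) ] ≤ 4e^{−x}. -/

import Mathlib

open MeasureTheory ProbabilityTheory

/-- Squared Euclidean norm of a vector in `ℝ^m`. -/
def sqNorm {m : ℕ} (v : Fin m → ℝ) : ℝ := ∑ i, (v i) ^ 2

/-- Euclidean inner product on `ℝ^m`. -/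
def innerR {m : ℕ} (u v : Fin m → ℝ) : ℝ := ∑ i, u i * v i

/-- First half of a vector in `ℝ^{2k}`. -/
def firstHalf {k : ℕ} (v : Fin (k + k) → ℝ) : Fin k → ℝ := fun i => v (Fin.castAdd k i)

/-- Exponential moment of a quadratic polynomial of a centered Gaussian variable. -/
lemma lintegral_exp_quadratic_gaussianReal {v : NNReal} (hv : v ≠ 0) (c : ℝ) {d : ℝ}
    (hd : 0 ≤ d) :
    ∫⁻ y, ENNReal.ofReal (Real.exp (c * y - d * y ^ 2)) ∂(gaussianReal 0 v)
      = ENNReal.ofReal ((√(1 + 2 * d * v))⁻¹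
          * Real.exp (c ^ 2 * v / (2 * (1 + 2 * d * v)))) := by
  have hv0 : (0 : ℝ) < v := by exact_mod_cast pos_iff_ne_zero.mpr hv
  have hr : 0 < 1 + 2 * d * (v : ℝ) := by positivity
  set r : NNReal := ⟨1 + 2 * d * v, hr.le⟩
  have hrr : (r : ℝ) = 1 + 2 * d * v := rfl
  have hr0 : (0 : ℝ) < r := hr
  have hw : v / r ≠ 0 := div_ne_zero hv (by exact_mod_cast hr0.ne')
  rw [← hrr, gaussianReal_of_var_ne_zero _ hv,
    lintegral_withDensity_eq_lintegral_mul _ (measurable_gaussianPDF _ _) (by fun_prop)]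
  have key : ∀ y : ℝ,
      (gaussianPDF 0 v * fun y => ENNReal.ofReal (Real.exp (c * y - d * y ^ 2))) y
        = ENNReal.ofReal ((√(r : ℝ))⁻¹ * Real.exp (c ^ 2 * v / (2 * r)))
          * ENNReal.ofReal (gaussianPDFReal (c * (v / r)) (v / r) y) := by
    intro y
    rw [Pi.mul_apply, gaussianPDF, ← ENNReal.ofReal_mul (gaussianPDFReal_nonneg _ _ _),
      ← ENNReal.ofReal_mul (by positivity)]
    congr 1
    simp only [gaussianPDFReal, NNReal.coe_div]
    have hsqrt : √(2 * Real.pi * (v / r : ℝ)) = √(2 * Real.pi * v) / √(r : ℝ) := by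
      rw [← Real.sqrt_div (by positivity), mul_div_assoc]
    have hexp : -(y - 0) ^ 2 / (2 * v) + (c * y - d * y ^ 2)
        = c ^ 2 * v / (2 * r) + -(y - c * (v / r)) ^ 2 / (2 * (v / r : ℝ)) := by
      have hdr : d = (r - 1) / (2 * v) := by rw [hrr]; field_simp; ring
      rw [hdr]
      field_simp
      ring
    have hsr : √(r : ℝ) ≠ 0 := (Real.sqrt_pos.mpr hr0).ne'
    rw [hsqrt, mul_assoc, ← Real.exp_add, hexp, Real.exp_add]
    field_simp
  simp_rw [key]
  rw [lintegral_const_mul _ (by fun_prop), lintegral_gaussianPDFReal_eq_one _ hw, mul_one]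

lemma lintegral_pi_exp_sum {ι : Type*} [Fintype ι] (ν : Measure ℝ) [IsProbabilityMeasure ν]
    (f : ι → ℝ → ℝ) (hf : ∀ i, Measurable (f i)) :
    ∫⁻ y, ENNReal.ofReal (Real.exp (∑ i, f i (y i))) ∂(Measure.pi fun _ : ι => ν)
      = ∏ i, ∫⁻ t, ENNReal.ofReal (Real.exp (f i t)) ∂ν := by
  have hmeas : ∀ i, Measurable fun t => ENNReal.ofReal (Real.exp (f i t)) := fun i => by
    have := hf i
    fun_prop
  have hind := iIndepFun_pi (μ := fun _ : ι => ν)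
    (X := fun i t => ENNReal.ofReal (Real.exp (f i t))) fun i => (hmeas i).aemeasurable
  have hprod : ∀ y : ι → ℝ, ENNReal.ofReal (Real.exp (∑ i, f i (y i)))
      = ∏ i, ENNReal.ofReal (Real.exp (f i (y i))) := fun y => by
    rw [Real.exp_sum, ENNReal.ofReal_prod_of_nonneg fun i _ => (Real.exp_pos _).le]
  simp_rw [hprod]
  rw [lintegral_prod_eq_prod_lintegral_of_indepFun _ _ hind
    fun i => (hmeas i).comp (measurable_pi_apply i)]
  exact Finset.prod_congr rfl fun i _ =>
    (measurePreserving_eval (fun _ : ι => ν) i).lintegral_comp (hmeas i)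

/-- The chosen exponential moment gains a factor `exp (-t / 2)` per coordinate, uniformly in the
value `a` of the other vector's coordinate. -/
lemma lintegral_exp_tilted_gaussianReal_le {v : NNReal} (hv : v ≠ 0) {t : ℝ} (ht0 : 0 ≤ t)
    (ht : t ≤ 1 / 2) {c a : ℝ} (hc : c ^ 2 = 100 * t / v ^ 2 * a ^ 2) :
    ∫⁻ y, ENNReal.ofReal (Real.exp (c * y - 50 * t / v * y ^ 2 - 50 * t / v * a ^ 2))
        ∂(gaussianReal 0 v)
      ≤ ENNReal.ofReal (Real.exp (-(t / 2))) := by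
  have hv0 : (0 : ℝ) < v := by exact_mod_cast pos_iff_ne_zero.mpr hv
  have hr : 1 + 2 * (50 * t / v) * (v : ℝ) = 1 + 100 * t := by field_simp; ring
  simp_rw [sub_eq_add_neg _ (50 * t / (v : ℝ) * a ^ 2), Real.exp_add,
    ENNReal.ofReal_mul (Real.exp_pos _).le]
  rw [lintegral_mul_const _ (by fun_prop),
    lintegral_exp_quadratic_gaussianReal hv c (by positivity), hr,
    ← ENNReal.ofReal_mul (by positivity)]
  refine ENNReal.ofReal_le_ofReal ?_
  have hsqrt : (√(1 + 100 * t))⁻¹ ≤ Real.exp (-(t / 2)) := by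
    rw [Real.exp_neg]
    refine inv_anti₀ (Real.exp_pos _) (Real.le_sqrt_of_sq_le ?_)
    rw [← Real.exp_nat_mul]
    have h1 : Real.exp t * (1 - t) ≤ 1 := by
      calc Real.exp t * (1 - t) ≤ Real.exp t * Real.exp (-t) := by
            gcongr; linarith [Real.add_one_le_exp (-t)]
        _ = 1 := by rw [← Real.exp_add]; simp
    have h2 : ((2 : ℕ) : ℝ) * (t / 2) = t := by push_cast; ring
    rw [h2]
    nlinarith [Real.exp_pos t]
  have hquad : c ^ 2 * v / (2 * (1 + 100 * t)) ≤ 50 * t / v * a ^ 2 := by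
    have h : c ^ 2 * v = 2 * (50 * t / v * a ^ 2) := by rw [hc]; field_simp; ring
    rw [h, div_le_iff₀ (by positivity)]
    have : 0 ≤ 50 * t / v * a ^ 2 := by positivity
    nlinarith
  rw [mul_assoc, ← Real.exp_add]
  calc _ ≤ Real.exp (-(t / 2)) * 1 := by
        gcongr
        exact Real.exp_le_one_iff.mpr (by linarith)
    _ = _ := mul_one _

/-- One-sided lower-deviation bound (Eq. (bound-c) of the paper) for the inner
product of the first halves of two independent Gaussian vectors in `ℝ^{2k}`. -/
theorem inner_product_one_sided_bound
    {Ω : Type*} [MeasurableSpace Ω] (μ : Measure Ω) [IsProbabilityMeasure μ]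
    (k : ℕ) (hk : 0 < k) (σX σY : ℝ) (hσX : 0 < σX ^ 2) (hσY : 0 < σY ^ 2)
    (X Y : Ω → (Fin (k + k) → ℝ))
    (hXmeas : Measurable X) (hYmeas : Measurable Y)
    (hindep : IndepFun X Y μ)
    (hXdist : Measure.map X μ = Measure.pi fun _ : Fin (k + k) => gaussianReal 0 ⟨σX ^ 2, hσX.le⟩)
    (hYdist : Measure.map Y μ = Measure.pi fun _ : Fin (k + k) => gaussianReal 0 ⟨σY ^ 2, hσY.le⟩)
    (x : ℝ) (hx0 : 0 < x) (hxk : x ≤ (k : ℝ) / 2) :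
    μ {ω | innerR (firstHalf (X ω)) (firstHalf (Y ω))
        ≤ (1 / 2) * innerR (X ω) (Y ω)
          - (5 / 2) * Real.sqrt (x / k) * (sqNorm (X ω) + sqNorm (Y ω))}
      ≤ ENNReal.ofReal (4 * Real.exp (-x)) := by
  set v : NNReal := ⟨σY ^ 2, hσY.le⟩
  have hv0 : (0 : ℝ) < v := hσY
  have hv : v ≠ 0 := by exact_mod_cast hv0.ne'
  have hk0 : (0 : ℝ) < k := by exact_mod_cast hk
  set t : ℝ := x / k with htdef
  have ht0 : 0 ≤ t := by positivity
  have ht : t ≤ 1 / 2 := by rw [htdef, div_le_iff₀ hk0]; linarith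
  have hss : √t ^ 2 = t := Real.sq_sqrt ht0
  set ε : Fin (k + k) → ℝ := Fin.append (fun _ => 1) (fun _ => -1) with hεdef
  have hε : ∀ i, ε i ^ 2 = 1 := fun i => by
    refine Fin.addCases (fun i => ?_) (fun i => ?_) i <;> simp [hεdef, -Fin.natAdd_eq_addNat]
  let f (a : Fin (k + k) → ℝ) (i : Fin (k + k)) (y : ℝ) : ℝ :=
    -(10 * √t / v * ε i * a i) * y - 50 * t / v * y ^ 2 - 50 * t / v * a i ^ 2
  let F (p : (Fin (k + k) → ℝ) × (Fin (k + k) → ℝ)) : ENNReal :=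
    ENNReal.ofReal (Real.exp (∑ i, f p.1 i (p.2 i)))
  have hF : Measurable F := by
    simp only [F, f]
    fun_prop
  have hprob : IsProbabilityMeasure (μ.map X) :=
    Measure.isProbabilityMeasure_map hXmeas.aemeasurable
  have hsum (a y : Fin (k + k) → ℝ) : ∑ i, f a i (y i)
      = 20 * √t / v * (1 / 2 * innerR a y - 5 / 2 * √t * (sqNorm a + sqNorm y)
          - innerR (firstHalf a) (firstHalf y)) := by
    have hsplit : innerR (firstHalf a) (firstHalf y)
        = 1 / 2 * innerR a y + 1 / 2 * ∑ i, ε i * (a i * y i) := by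
      simp [innerR, firstHalf, Fin.sum_univ_add, hεdef, -Fin.natAdd_eq_addNat]
      ring
    rw [hsplit]
    calc ∑ i, f a i (y i) = -(10 * √t / v) * ∑ i, ε i * (a i * y i)
          - 50 * t / v * sqNorm y - 50 * t / v * sqNorm a := by
          simp only [f, sqNorm, Finset.mul_sum, ← Finset.sum_sub_distrib]
          exact Finset.sum_congr rfl fun i _ => by ring
      _ = _ := by
          nth_rewrite 2 3 [← hss]
          ring
  have hinner (a : Fin (k + k) → ℝ) :
      ∫⁻ y, F (a, y) ∂(μ.map Y) ≤ ENNReal.ofReal (Real.exp (-x)) := by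
    rw [hYdist, lintegral_pi_exp_sum _ (f a) fun i => by fun_prop]
    calc _ ≤ ∏ _i : Fin (k + k), ENNReal.ofReal (Real.exp (-(t / 2))) :=
          Finset.prod_le_prod' fun i _ =>
            lintegral_exp_tilted_gaussianReal_le hv ht0 ht (by
              rw [neg_sq, mul_pow, mul_pow, hε, div_pow, mul_pow, hss]; ring)
      _ = ENNReal.ofReal (Real.exp (-x)) := by
          rw [Finset.prod_const, Finset.card_univ, Fintype.card_fin,
            ← ENNReal.ofReal_pow (Real.exp_pos _).le, ← Real.exp_nat_mul]
          congr 2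
          rw [htdef]
          push_cast
          field_simp
          ring
  calc μ _ ≤ μ {ω | 1 ≤ F (X ω, Y ω)} := by
        refine measure_mono fun ω hω => ?_
        simp only [Set.mem_ofPred_eq] at hω ⊢
        simp only [F]
        rw [ENNReal.one_le_ofReal, Real.one_le_exp_iff, hsum]
        exact mul_nonneg (by positivity) (by linarith)
    _ ≤ ∫⁻ ω, F (X ω, Y ω) ∂μ := by
        simpa using mul_meas_ge_le_lintegral (μ := μ) (hF.comp (hXmeas.prodMk hYmeas)) 1
    _ = ∫⁻ p, F p ∂((μ.map X).prod (μ.map Y)) := by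
        rw [← hindep.map_prod_eq_prod_map_map hXmeas.aemeasurable hYmeas.aemeasurable,
          lintegral_map hF (hXmeas.prodMk hYmeas)]
    _ = ∫⁻ a, ∫⁻ y, F (a, y) ∂(μ.map Y) ∂(μ.map X) := by
        have : IsProbabilityMeasure (μ.map Y) :=
          Measure.isProbabilityMeasure_map hYmeas.aemeasurable
        exact lintegral_prod _ hF.aemeasurable
    _ ≤ ∫⁻ _, ENNReal.ofReal (Real.exp (-x)) ∂(μ.map X) := lintegral_mono hinner
    _ = ENNReal.ofReal (Real.exp (-x)) := by simp
    _ ≤ ENNReal.ofReal (4 * Real.exp (-x)) :=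
        ENNReal.ofReal_le_ofReal (by linarith [Real.exp_pos (-x)])
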